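/- arXiv:2308.01896 — 2 statements merged into one kernel-verified Lean document; each statement's English description precedes it below -/
import Mathlib

section
/- There exist universal constants c_1, c_2 > 0 such that the following holds. Let X_1,…,X_n be i.i.d. real-valued random variables with cumulative distribution function F(x) = P(X_1 ≤ x) and empirical cumulative distribution function F_n(x) = (1/n)∑_{i=1}^n 1{X_i ≤ x}. For any x_0 ≤ x_1 in ℝ ∪ {±∞} and any t ≥ 0, setting V = sup_{x∈[x_0,x_1]} F(x)(1−F(x)) (with the conventions F(−∞) = 0 and F(+∞) = 1), one has P( sup_{x∈[x_0,x_1]} |F_n(x) − F(x)| > t·√(V/n) ) ≤ c_1 · exp(−c_2 · min(t², t·√(nV))). -/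
open MeasureTheory ProbabilityTheory Filter ENNReal

/-- The cumulative distribution function of a measure `ν` on `ℝ`. -/
noncomputable def cdfOf (ν : Measure ℝ) (x : ℝ) : ℝ := (ν (Set.Iic x)).toReal

/-- The empirical cumulative distribution function of samples `ω : Fin n → ℝ`. -/
noncomputable def ecdf (n : ℕ) (ω : Fin n → ℝ) (x : ℝ) : ℝ :=
  (∑ i, if ω i ≤ x then (1 : ℝ) else 0) / n

/-- The indicator of `S`, centred at its mean and divided by the measure of the complement. As `S`
grows along a chain, this is a martingale. -/
noncomputable def normalizedIndicator {E : Type*} [MeasurableSpace E] (ν : Measure E) (S : Set E)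
    (u : E) : ℝ :=
  (S.indicator 1 u - ν.real S) / (1 - ν.real S)

section NormalizedIndicator

variable {E : Type*} [MeasurableSpace E] {ν : Measure E} {S : Set E}

lemma integrable_indicator_one_real [IsProbabilityMeasure ν] (hS : MeasurableSet S) :
    Integrable (S.indicator (1 : E → ℝ)) ν :=
  (integrable_const (1 : ℝ)).indicator hS

lemma measurable_normalizedIndicator (hS : MeasurableSet S) :
    Measurable (normalizedIndicator ν S) := by
  unfold normalizedIndicator
  exact ((measurable_one.indicator hS).sub_const _).div_const _

lemma normalizedIndicator_of_mem (h1 : ν.real S < 1) {u : E} (hu : u ∈ S) :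
    normalizedIndicator ν S u = 1 := by
  have : 1 - ν.real S ≠ 0 := by linarith
  simp [normalizedIndicator, hu, this]

lemma normalizedIndicator_of_notMem {u : E} (hu : u ∉ S) :
    normalizedIndicator ν S u = -(ν.real S / (1 - ν.real S)) := by
  simp [normalizedIndicator, hu, neg_div]

lemma abs_normalizedIndicator_le_one (hS : ν.real S ≤ 1 / 2) (u : E) :
    |normalizedIndicator ν S u| ≤ 1 := by
  by_cases hu : u ∈ S
  · simp [normalizedIndicator_of_mem (by linarith) hu]
  · have h0 : 0 ≤ ν.real S := measureReal_nonneg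
    rw [normalizedIndicator_of_notMem hu, abs_neg,
      abs_of_nonneg (div_nonneg h0 (by linarith)), div_le_one (by linarith)]
    linarith

variable [IsProbabilityMeasure ν]

lemma integrable_normalizedIndicator (hS : MeasurableSet S) :
    Integrable (normalizedIndicator ν S) ν := by
  unfold normalizedIndicator
  exact ((integrable_indicator_one_real hS).sub (integrable_const _)).div_const _

lemma integral_normalizedIndicator (hS : MeasurableSet S) :
    ∫ u, normalizedIndicator ν S u ∂ν = 0 := by
  unfold normalizedIndicator
  rw [integral_div, integral_sub (integrable_indicator_one_real hS) (integrable_const _),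
    integral_indicator_one hS]
  simp

lemma integral_normalizedIndicator_sq (hS : MeasurableSet S) (h1 : ν.real S < 1) :
    ∫ u, normalizedIndicator ν S u ^ 2 ∂ν = ν.real S / (1 - ν.real S) := by
  have hne : 1 - ν.real S ≠ 0 := by linarith
  have hsq : ∀ u, normalizedIndicator ν S u ^ 2 =
      (1 - (ν.real S / (1 - ν.real S)) ^ 2) * S.indicator 1 u
        + (ν.real S / (1 - ν.real S)) ^ 2 := by
    intro u
    by_cases hu : u ∈ S
    · simp [normalizedIndicator_of_mem h1 hu, hu]
    · simp [normalizedIndicator_of_notMem hu, hu]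
  simp_rw [hsq]
  rw [integral_add ((integrable_indicator_one_real hS).const_mul _) (integrable_const _),
    integral_const_mul, integral_indicator_one hS]
  simp only [integral_const, probReal_univ, smul_eq_mul, one_mul]
  field_simp
  ring

lemma integral_exp_normalizedIndicator_le (hS : MeasurableSet S) {p : ℝ} (hp : p ≤ 1 / 2)
    (hSp : ν.real S ≤ p) {l : ℝ} (hl : |l| ≤ 1) :
    ∫ u, Real.exp (l * normalizedIndicator ν S u) ∂ν ≤ Real.exp (2 * p * l ^ 2) := by
  have h0 : 0 ≤ ν.real S := measureReal_nonneg
  have habs := abs_normalizedIndicator_le_one (hSp.trans hp)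
  have hmul : ∀ u, |l * normalizedIndicator ν S u| ≤ 1 := fun u => by
    rw [abs_mul]; exact mul_le_one₀ hl (abs_nonneg _) (habs u)
  have hm : Measurable fun u => l * normalizedIndicator ν S u :=
    (measurable_normalizedIndicator hS).const_mul l
  have hint : Integrable (fun u => Real.exp (l * normalizedIndicator ν S u)) ν := by
    refine Integrable.of_bound hm.exp.aestronglyMeasurable (Real.exp 1) (ae_of_all _ fun u => ?_)
    rw [Real.norm_eq_abs, Real.abs_exp]
    exact Real.exp_le_exp.2 ((le_abs_self _).trans (hmul u))
  have hi1 : Integrable (fun u => l * normalizedIndicator ν S u) ν :=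
    (integrable_normalizedIndicator hS).const_mul l
  have hi2 : Integrable (fun u => l ^ 2 * normalizedIndicator ν S u ^ 2) ν := by
    refine Integrable.of_bound
      (((measurable_normalizedIndicator hS).pow_const 2).const_mul _).aestronglyMeasurable 1
      (ae_of_all _ fun u => ?_)
    rw [← mul_pow, norm_pow, Real.norm_eq_abs]
    exact pow_le_one₀ (abs_nonneg _) (hmul u)
  calc ∫ u, Real.exp (l * normalizedIndicator ν S u) ∂ν
      ≤ ∫ u, (1 + l * normalizedIndicator ν S u + l ^ 2 * normalizedIndicator ν S u ^ 2) ∂ν := by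
        refine integral_mono hint (((integrable_const 1).add hi1).add hi2) fun u => ?_
        have := (abs_le.1 (Real.abs_exp_sub_one_sub_id_le (hmul u))).2
        simp only
        nlinarith
    _ = 1 + l ^ 2 * (ν.real S / (1 - ν.real S)) := by
        rw [integral_add (f := fun u => 1 + l * normalizedIndicator ν S u)
          ((integrable_const 1).add hi1) hi2, integral_add (integrable_const 1) hi1,
          integral_const_mul, integral_const_mul, integral_normalizedIndicator hS,
          integral_normalizedIndicator_sq hS (by linarith)]
        simp
    _ ≤ 1 + 2 * p * l ^ 2 := by
        have : ν.real S / (1 - ν.real S) ≤ 2 * p := by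
          rw [div_le_iff₀ (by linarith)]
          nlinarith
        nlinarith [sq_nonneg l]
    _ ≤ Real.exp (2 * p * l ^ 2) := by
        linarith [Real.add_one_le_exp (2 * p * l ^ 2)]

end NormalizedIndicator

lemma integral_mul_eval_eq_zero {ι E : Type*} [Fintype ι] [DecidableEq ι] [MeasurableSpace E]
    {ν : Measure E} [IsProbabilityMeasure ν] (i : ι) {S : Set E}
    {g : (ι → E) → ℝ} (hg : Measurable g) {h : E → ℝ} (hh : Measurable h)
    (hgS : ∀ ω, ω i ∉ S → ∀ v, v ∉ S → g (Function.update ω i v) = g ω)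
    (hhS : ∀ u ∈ S, h u = 0) (hh0 : ∫ u, h u ∂ν = 0) :
    ∫ ω, g ω * h (ω i) ∂(Measure.pi fun _ : ι => ν) = 0 := by
  rcases Sᶜ.eq_empty_or_nonempty with hS | ⟨v, hv⟩
  · have : ∀ u, h u = 0 := fun u => hhS u (by simp [Set.compl_empty_iff.1 hS])
    simp [this]
  have hcongr : ∀ ω : ι → E, g ω * h (ω i) = g (Function.update ω i v) * h (ω i) := by
    intro ω
    by_cases hω : ω i ∈ S
    · simp [hhS _ hω]
    · rw [hgS ω hω v hv]
  have hind : iIndepFun (fun (j : ι) (ω : ι → E) => ω j) (Measure.pi fun _ : ι => ν) :=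
    iIndepFun_pi (X := fun _ => id) fun _ => aemeasurable_id
  have hind' := hind.indepFun_finset (Finset.univ.erase i) {i} (by simp)
    fun j => measurable_pi_apply j
  let φ : ({j // j ∈ Finset.univ.erase i} → E) → ι → E :=
    fun x j => if hj : j = i then v else x ⟨j, by simp [hj]⟩
  have hφ : Measurable φ := by
    refine measurable_pi_lambda _ fun j => ?_
    by_cases hj : j = i
    · simp [φ, hj]
    · simpa [φ, hj] using measurable_pi_apply _
  have hφup : ∀ ω : ι → E, Function.update ω i v = φ fun j => ω j := by
    intro ω
    ext j
    by_cases hj : j = i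
    · subst hj; simp [φ]
    · simp [φ, hj]
  have hind'' : IndepFun (fun ω : ι → E => g (Function.update ω i v)) (fun ω => h (ω i))
      (Measure.pi fun _ : ι => ν) := by
    have hψ : Measurable fun x : {j // j ∈ ({i} : Finset ι)} → E => h (x ⟨i, by simp⟩) :=
      hh.comp (measurable_pi_apply _)
    have := hind'.comp (hg.comp hφ) hψ
    simpa only [hφup, Function.comp_def] using this
  simp_rw [hcongr]
  rw [hind''.integral_fun_mul_eq_mul_integral
    (hg.comp (measurable_update_left)).aestronglyMeasurable
    (hh.comp (measurable_pi_apply i)).aestronglyMeasurable]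
  rw [integral_comp_eval (μ := fun _ : ι => ν) hh.aestronglyMeasurable, hh0, mul_zero]

/-- The sum of `normalizedIndicator ν S` over the coordinates of `ω`. -/
noncomputable def normalizedSum {ι E : Type*} [Fintype ι] [MeasurableSpace E] (ν : Measure E)
    (S : Set E) (ω : ι → E) : ℝ :=
  ∑ i, normalizedIndicator ν S (ω i)

section NormalizedSum

variable {ι E : Type*} [Fintype ι] [MeasurableSpace E] {ν : Measure E} {S T : Set E}

lemma measurable_normalizedSum (hS : MeasurableSet S) :
    Measurable (normalizedSum ν S : (ι → E) → ℝ) := by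
  unfold normalizedSum
  exact Finset.measurable_sum _ fun i _ =>
    (measurable_normalizedIndicator hS).comp (measurable_pi_apply i)

lemma abs_normalizedSum_le (hS : ν.real S ≤ 1 / 2) (ω : ι → E) :
    |normalizedSum ν S ω| ≤ Fintype.card ι := by
  refine (Finset.abs_sum_le_sum_abs _ _).trans ?_
  refine (Finset.sum_le_sum fun i _ => abs_normalizedIndicator_le_one hS (ω i)).trans ?_
  simp

lemma normalizedSum_update [DecidableEq ι] (hST : S ⊆ T) {ω : ι → E} {i : ι} (hi : ω i ∉ T) {v : E}
    (hv : v ∉ T) : normalizedSum ν S (Function.update ω i v) = normalizedSum ν S ω := by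
  unfold normalizedSum
  refine Finset.sum_congr rfl fun j _ => ?_
  by_cases hj : j = i
  · subst hj
    rw [Function.update_self, normalizedIndicator_of_notMem fun h => hv (hST h),
      normalizedIndicator_of_notMem fun h => hi (hST h)]
  · rw [Function.update_of_ne hj]

lemma normalizedSum_eq (S : Set E) (ω : ι → E) : normalizedSum ν S ω =
    ((∑ i, S.indicator 1 (ω i)) - Fintype.card ι * ν.real S) / (1 - ν.real S) := by
  simp [normalizedSum, normalizedIndicator, ← Finset.sum_div]

variable [IsProbabilityMeasure ν]

lemma integrable_of_measurable_of_abs_le {Ω : Type*} [MeasurableSpace Ω] {μ : Measure Ω}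
    [IsFiniteMeasure μ] {f : Ω → ℝ} (hf : Measurable f) {C : ℝ} (hC : ∀ ω, |f ω| ≤ C) :
    Integrable f μ :=
  Integrable.of_bound hf.aestronglyMeasurable C (ae_of_all _ hC)

lemma integral_mul_normalizedSum_sub [DecidableEq ι] (hS : MeasurableSet S) (hT : MeasurableSet T)
    (hST : S ⊆ T) (hT2 : ν.real T ≤ 1 / 2) {g : (ι → E) → ℝ} (hg : Measurable g) {C : ℝ}
    (hgC : ∀ ω, |g ω| ≤ C)
    (hgS : ∀ i ω, ω i ∉ S → ∀ v, v ∉ S → g (Function.update ω i v) = g ω) :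
    ∫ ω, g ω * (normalizedSum ν T ω - normalizedSum ν S ω) ∂(Measure.pi fun _ : ι => ν) = 0 := by
  have hS2 : ν.real S ≤ 1 / 2 := (measureReal_mono hST).trans hT2
  have hd : Measurable fun u => normalizedIndicator ν T u - normalizedIndicator ν S u :=
    (measurable_normalizedIndicator hT).sub (measurable_normalizedIndicator hS)
  have hdb : ∀ u, |normalizedIndicator ν T u - normalizedIndicator ν S u| ≤ 2 := fun u => by
    have h1 := abs_normalizedIndicator_le_one hT2 u
    have h2 := abs_normalizedIndicator_le_one hS2 u
    have h3 := abs_sub (normalizedIndicator ν T u) (normalizedIndicator ν S u)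
    linarith
  simp only [normalizedSum, ← Finset.sum_sub_distrib, Finset.mul_sum]
  rw [integral_finsetSum]
  · refine Finset.sum_eq_zero fun i _ => ?_
    refine integral_mul_eval_eq_zero (S := S) i hg hd (hgS i) (fun u hu => ?_) ?_
    · rw [normalizedIndicator_of_mem (by linarith) (hST hu),
        normalizedIndicator_of_mem (by linarith) hu, sub_self]
    · rw [integral_sub (integrable_normalizedIndicator hT) (integrable_normalizedIndicator hS),
        integral_normalizedIndicator hT, integral_normalizedIndicator hS, sub_self]
  · intro i _
    refine integrable_of_measurable_of_abs_le (C := C * 2)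
      (hg.mul (hd.comp (measurable_pi_apply i))) fun ω => ?_
    rw [abs_mul]
    exact mul_le_mul (hgC ω) (hdb _) (abs_nonneg _) ((abs_nonneg _).trans (hgC ω))

lemma integral_exp_normalizedSum_le (hS : MeasurableSet S) {p : ℝ} (hp : p ≤ 1 / 2)
    (hSp : ν.real S ≤ p) {l : ℝ} (hl : |l| ≤ 1) :
    ∫ ω, Real.exp (l * normalizedSum ν S ω) ∂(Measure.pi fun _ : ι => ν)
      ≤ Real.exp (2 * Fintype.card ι * p * l ^ 2) := by
  simp only [normalizedSum, Finset.mul_sum, Real.exp_sum]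
  rw [integral_fintype_prod_eq_pow (fun u => Real.exp (l * normalizedIndicator ν S u))]
  refine (pow_le_pow_left₀ (integral_nonneg fun _ => (Real.exp_pos _).le)
    (integral_exp_normalizedIndicator_le hS hp hSp hl) _).trans_eq ?_
  rw [← Real.exp_nat_mul]
  ring_nf

lemma setIntegral_exp_normalizedSum_mono [DecidableEq ι] (hS : MeasurableSet S)
    (hT : MeasurableSet T) (hST : S ⊆ T) (hT2 : ν.real T ≤ 1 / 2) (l : ℝ) {A : Set (ι → E)}
    (hA : MeasurableSet A)
    (hAS : ∀ i ω, ω i ∉ S → ∀ v, v ∉ S → (Function.update ω i v ∈ A ↔ ω ∈ A)) :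
    ∫ ω in A, Real.exp (l * normalizedSum ν S ω) ∂(Measure.pi fun _ : ι => ν)
      ≤ ∫ ω in A, Real.exp (l * normalizedSum ν T ω) ∂(Measure.pi fun _ : ι => ν) := by
  have hS2 : ν.real S ≤ 1 / 2 := (measureReal_mono hST).trans hT2
  have hexpm : ∀ {U : Set E}, MeasurableSet U →
      Measurable fun ω : ι → E => Real.exp (l * normalizedSum ν U ω) := fun hU =>
    ((measurable_normalizedSum hU).const_mul l).exp
  have hexpb : ∀ {U : Set E}, ν.real U ≤ 1 / 2 → ∀ ω : ι → E,
      |Real.exp (l * normalizedSum ν U ω)| ≤ Real.exp (|l| * Fintype.card ι) := fun hU ω => by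
    rw [Real.abs_exp]
    refine Real.exp_le_exp.2 ((le_abs_self _).trans ?_)
    rw [abs_mul]
    exact mul_le_mul_of_nonneg_left (abs_normalizedSum_le hU ω) (abs_nonneg l)
  have hint : ∀ {U : Set E}, MeasurableSet U → ν.real U ≤ 1 / 2 →
      Integrable (A.indicator fun ω : ι → E => Real.exp (l * normalizedSum ν U ω))
        (Measure.pi fun _ : ι => ν) := fun hU hU2 =>
    (integrable_of_measurable_of_abs_le (hexpm hU) (hexpb hU2)).indicator hA
  set g : (ι → E) → ℝ := A.indicator fun ω => l * Real.exp (l * normalizedSum ν S ω) with hgdef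
  have hg : Measurable g := ((hexpm hS).const_mul l).indicator hA
  have hgC : ∀ ω, |g ω| ≤ |l| * Real.exp (|l| * Fintype.card ι) := fun ω => by
    rw [hgdef, ← Real.norm_eq_abs]
    refine (norm_indicator_le_norm_self _ _).trans ?_
    rw [Real.norm_eq_abs, abs_mul]
    exact mul_le_mul_of_nonneg_left (hexpb hS2 ω) (abs_nonneg l)
  have hzero := integral_mul_normalizedSum_sub hS hT hST hT2 hg hgC fun i ω hi v hv => by
    by_cases hω : ω ∈ A
    · simp only [hgdef, Set.indicator_of_mem hω, Set.indicator_of_mem ((hAS i ω hi v hv).2 hω),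
        normalizedSum_update subset_rfl hi hv]
    · simp only [hgdef, Set.indicator_of_notMem hω,
        Set.indicator_of_notMem (mt (hAS i ω hi v hv).1 hω)]
  have hgint : Integrable (fun ω => g ω * (normalizedSum ν T ω - normalizedSum ν S ω))
      (Measure.pi fun _ : ι => ν) := by
    refine integrable_of_measurable_of_abs_le
      (C := |l| * Real.exp (|l| * Fintype.card ι) * (Fintype.card ι + Fintype.card ι))
      (hg.mul ((measurable_normalizedSum hT).sub (measurable_normalizedSum hS))) fun ω => ?_
    rw [abs_mul]
    exact mul_le_mul (hgC ω) ((abs_sub _ _).trans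
      (add_le_add (abs_normalizedSum_le hT2 ω) (abs_normalizedSum_le hS2 ω))) (abs_nonneg _)
      (by positivity)
  rw [← integral_indicator hA, ← integral_indicator hA]
  calc ∫ ω, A.indicator (fun ω => Real.exp (l * normalizedSum ν S ω)) ω ∂(Measure.pi fun _ => ν)
      = ∫ ω, (A.indicator (fun ω => Real.exp (l * normalizedSum ν S ω)) ω
          + g ω * (normalizedSum ν T ω - normalizedSum ν S ω)) ∂(Measure.pi fun _ => ν) := by
        rw [integral_add (hint hS hS2) hgint, hzero, add_zero]
    _ ≤ _ := by
        refine integral_mono ((hint hS hS2).add hgint) (hint hT hT2) fun ω => ?_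
        by_cases hω : ω ∈ A
        · simp only [hgdef, Set.indicator_of_mem hω]
          have h1 := Real.add_one_le_exp (l * normalizedSum ν T ω - l * normalizedSum ν S ω)
          have h2 := mul_le_mul_of_nonneg_left h1 (Real.exp_pos (l * normalizedSum ν S ω)).le
          rw [← Real.exp_add, add_sub_cancel] at h2
          linarith
        · simp [hgdef, hω]

/-- Doob's maximal inequality for the exponential of `normalizedSum` along a finite chain. -/
lemma measureReal_exists_le_mul_normalizedSum_le {κ : Type*} [LinearOrder κ] {S : κ → Set E}
    (hSm : ∀ k, MeasurableSet (S k)) (hmono : Monotone S) {p : ℝ} (hp : p ≤ 1 / 2)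
    (K : Finset κ) (hK : ∀ k ∈ K, ν.real (S k) ≤ p) {l : ℝ} (hl : |l| ≤ 1) (c : ℝ) :
    (Measure.pi fun _ : ι => ν).real {ω | ∃ k ∈ K, c ≤ l * normalizedSum ν (S k) ω}
      ≤ Real.exp (2 * Fintype.card ι * p * l ^ 2 - c) := by
  classical
  rcases K.eq_empty_or_nonempty with rfl | hne
  · simp [Real.exp_nonneg]
  set m := K.max' hne
  have hm2 : ν.real (S m) ≤ 1 / 2 := (hK m (K.max'_mem hne)).trans hp
  set P := Measure.pi fun _ : ι => ν
  let A : κ → Set (ι → E) := fun k =>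
    {ω | c ≤ l * normalizedSum ν (S k) ω ∧ ∀ j ∈ K, j < k → l * normalizedSum ν (S j) ω < c}
  have hmeas : ∀ k, Measurable fun ω : ι → E => l * normalizedSum ν (S k) ω := fun k =>
    (measurable_normalizedSum (hSm k)).const_mul l
  have hAm : ∀ k, MeasurableSet (A k) := fun k => by
    refine (measurableSet_le measurable_const (hmeas k)).inter ?_
    have : {ω : ι → E | ∀ j ∈ K, j < k → l * normalizedSum ν (S j) ω < c}
        = ⋂ j ∈ K, {ω | j < k → l * normalizedSum ν (S j) ω < c} := by
      ext; simp
    change MeasurableSet {ω : ι → E | ∀ j ∈ K, j < k → l * normalizedSum ν (S j) ω < c}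
    rw [this]
    refine Finset.measurableSet_biInter _ fun j _ => ?_
    by_cases hjk : j < k
    · simpa [hjk] using measurableSet_lt (hmeas j) measurable_const
    · simp [hjk]
  have hAdisj : (K : Set κ).PairwiseDisjoint A := by
    intro j hj k hk hjk
    refine Set.disjoint_left.2 fun ω hωj hωk => ?_
    rcases lt_or_gt_of_ne hjk with h | h
    · exact absurd hωj.1 (not_le.2 (hωk.2 j hj h))
    · exact absurd hωk.1 (not_le.2 (hωj.2 k hk h))
  have hcover : {ω : ι → E | ∃ k ∈ K, c ≤ l * normalizedSum ν (S k) ω} ⊆ ⋃ k ∈ K, A k := by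
    rintro ω ⟨k, hk, hck⟩
    have hne' : (K.filter fun j => c ≤ l * normalizedSum ν (S j) ω).Nonempty :=
      ⟨k, Finset.mem_filter.2 ⟨hk, hck⟩⟩
    have hmin := Finset.mem_filter.1 (Finset.min'_mem _ hne')
    refine Set.mem_biUnion hmin.1 ⟨hmin.2, fun j hj hlt => ?_⟩
    by_contra! hcon
    exact absurd (Finset.min'_le _ j (Finset.mem_filter.2 ⟨hj, hcon⟩)) (not_le.2 hlt)
  have hint : ∀ k ∈ K, Integrable (fun ω : ι → E => Real.exp (l * normalizedSum ν (S k) ω)) P :=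
    fun k hk => by
      refine integrable_of_measurable_of_abs_le (C := Real.exp (|l| * Fintype.card ι))
        (hmeas k).exp fun ω => ?_
      rw [Real.abs_exp]
      refine Real.exp_le_exp.2 ((le_abs_self _).trans ?_)
      rw [abs_mul]
      exact mul_le_mul_of_nonneg_left (abs_normalizedSum_le ((hK k hk).trans hp) ω) (abs_nonneg l)
  have hstep : ∀ k ∈ K, Real.exp c * P.real (A k)
      ≤ ∫ ω in A k, Real.exp (l * normalizedSum ν (S m) ω) ∂P := fun k hk => by
    have hkm : k ≤ m := K.le_max' k hk
    refine le_trans ?_ (setIntegral_exp_normalizedSum_mono (hSm k) (hSm m) (hmono hkm) hm2 l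
      (hAm k) fun i ω hi v hv => ?_)
    · refine setIntegral_ge_of_const_le_real (hAm k) (measure_ne_top _ _) (fun ω hω => ?_)
        (hint k hk).integrableOn
      exact Real.exp_le_exp.2 hω.1
    · simp only [A, Set.mem_ofPred_eq, normalizedSum_update subset_rfl hi hv]
      refine and_congr_right fun _ => forall_congr' fun j => forall_congr' fun _ =>
        forall_congr' fun hjk => ?_
      rw [normalizedSum_update (hmono hjk.le) hi hv]
  have hmain : Real.exp c * P.real {ω | ∃ k ∈ K, c ≤ l * normalizedSum ν (S k) ω}
      ≤ Real.exp (2 * Fintype.card ι * p * l ^ 2) := by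
    calc Real.exp c * P.real {ω | ∃ k ∈ K, c ≤ l * normalizedSum ν (S k) ω}
        ≤ Real.exp c * ∑ k ∈ K, P.real (A k) :=
          mul_le_mul_of_nonneg_left
            ((measureReal_mono hcover (measure_ne_top _ _)).trans
              (measureReal_biUnion_finset_le _ _)) (Real.exp_pos c).le
      _ ≤ ∑ k ∈ K, ∫ ω in A k, Real.exp (l * normalizedSum ν (S m) ω) ∂P := by
          rw [Finset.mul_sum]
          exact Finset.sum_le_sum hstep
      _ = ∫ ω in ⋃ k ∈ K, A k, Real.exp (l * normalizedSum ν (S m) ω) ∂P :=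
          (integral_biUnion_finset K (fun k _ => hAm k) hAdisj
            fun k _ => (hint m (K.max'_mem hne)).integrableOn).symm
      _ ≤ ∫ ω, Real.exp (l * normalizedSum ν (S m) ω) ∂P :=
          setIntegral_le_integral (hint m (K.max'_mem hne)) (ae_of_all _ fun _ => Real.exp_nonneg _)
      _ ≤ _ := integral_exp_normalizedSum_le (hSm m) hp (hK m (K.max'_mem hne)) hl
  rw [Real.exp_sub, le_div_iff₀ (Real.exp_pos c), mul_comm]
  exact hmain

lemma measure_exists_lt_abs_sum_indicator_sub_le_of_finset {κ : Type*} [LinearOrder κ]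
    {S : κ → Set E} (hSm : ∀ k, MeasurableSet (S k)) (hmono : Monotone S) {p : ℝ} (hp : p ≤ 1 / 2)
    (K : Finset κ) (hK : ∀ k ∈ K, ν.real (S k) ≤ p) {l : ℝ} (hl0 : 0 ≤ l) (hl1 : l ≤ 1) {s : ℝ}
    (hs : 0 ≤ s) :
    (Measure.pi fun _ : ι => ν)
        {ω | ∃ k ∈ K, s < |(∑ i, (S k).indicator 1 (ω i)) - Fintype.card ι * ν.real (S k)|}
      ≤ ENNReal.ofReal (2 * Real.exp (2 * Fintype.card ι * p * l ^ 2 - l * s)) := by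
  set P := Measure.pi fun _ : ι => ν
  have hsub : {ω : ι → E | ∃ k ∈ K,
        s < |(∑ i, (S k).indicator 1 (ω i)) - Fintype.card ι * ν.real (S k)|}
      ⊆ {ω | ∃ k ∈ K, l * s ≤ l * normalizedSum ν (S k) ω}
        ∪ {ω | ∃ k ∈ K, l * s ≤ -l * normalizedSum ν (S k) ω} := by
    rintro ω ⟨k, hk, hlt⟩
    have hq0 : 0 ≤ ν.real (S k) := measureReal_nonneg
    have hq1 := (hK k hk).trans hp
    have hpos : 0 < 1 - ν.real (S k) := by linarith
    have hmul : ∀ {d : ℝ}, s < d → s ≤ d / (1 - ν.real (S k)) := fun hd => by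
      rw [le_div_iff₀ hpos]
      nlinarith
    rcases lt_abs.1 hlt with h | h
    · refine Or.inl ⟨k, hk, mul_le_mul_of_nonneg_left ?_ hl0⟩
      rw [normalizedSum_eq]
      exact hmul h
    · refine Or.inr ⟨k, hk, ?_⟩
      rw [normalizedSum_eq, neg_mul, ← mul_neg, ← neg_div]
      exact mul_le_mul_of_nonneg_left (hmul h) hl0
  have hl : |l| ≤ 1 := by rwa [abs_of_nonneg hl0]
  have h1 := measureReal_exists_le_mul_normalizedSum_le (ι := ι) hSm hmono hp K hK hl (l * s)
  have h2 := measureReal_exists_le_mul_normalizedSum_le (ι := ι) hSm hmono hp K hK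
    (l := -l) (by rwa [abs_neg]) (l * s)
  rw [neg_sq] at h2
  rw [← ofReal_measureReal (measure_ne_top _ _)]
  refine ENNReal.ofReal_le_ofReal ?_
  calc _ ≤ _ := measureReal_mono hsub (measure_ne_top _ _)
    _ ≤ _ := measureReal_union_le _ _
    _ ≤ _ := by rw [two_mul]; exact add_le_add h1 h2

/-- A maximal Bernstein-type inequality for the empirical process indexed by a countable chain. -/
lemma measure_exists_lt_abs_sum_indicator_sub_le {κ : Type*} [LinearOrder κ]
    {S : κ → Set E} (hSm : ∀ k, MeasurableSet (S k)) (hmono : Monotone S) {p : ℝ} (hp : p ≤ 1 / 2)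
    {C : Set κ} (hC : C.Countable) (hCp : ∀ k ∈ C, ν.real (S k) ≤ p) {l : ℝ} (hl0 : 0 ≤ l)
    (hl1 : l ≤ 1) {s : ℝ} (hs : 0 ≤ s) :
    (Measure.pi fun _ : ι => ν)
        {ω | ∃ k ∈ C, s < |(∑ i, (S k).indicator 1 (ω i)) - Fintype.card ι * ν.real (S k)|}
      ≤ ENNReal.ofReal (2 * Real.exp (2 * Fintype.card ι * p * l ^ 2 - l * s)) := by
  classical
  have : Countable C := hC.to_subtype
  let U : Finset C → Set (ι → E) := fun K => {ω | ∃ k ∈ K.map (Function.Embedding.subtype _),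
    s < |(∑ i, (S k).indicator 1 (ω i)) - Fintype.card ι * ν.real (S k)|}
  have hU : Directed (· ⊆ ·) U := by
    refine Monotone.directed_le fun K L hKL ω => ?_
    rintro ⟨k, hk, hlt⟩
    exact ⟨k, Finset.map_subset_map.2 hKL hk, hlt⟩
  calc _ ≤ (Measure.pi fun _ : ι => ν) (⋃ K, U K) := by
        refine measure_mono ?_
        rintro ω ⟨k, hk, hlt⟩
        exact Set.mem_iUnion.2 ⟨{⟨k, hk⟩}, k, by simp, hlt⟩
    _ = ⨆ K, (Measure.pi fun _ : ι => ν) (U K) := hU.measure_iUnion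
    _ ≤ _ := iSup_le fun K =>
        measure_exists_lt_abs_sum_indicator_sub_le_of_finset hSm hmono hp _
          (fun k hk => by
            obtain ⟨x, -, rfl⟩ := Finset.mem_map.1 hk
            exact hCp _ x.2) hl0 hl1 hs

end NormalizedSum

lemma exists_countable_forall_lt_of_continuousWithinAt_Ici {I : Set ℝ} (hI : I.OrdConnected) :
    ∃ C ⊆ I, C.Countable ∧ ∀ f : ℝ → ℝ, (∀ x, ContinuousWithinAt f (Set.Ici x) x) →
      ∀ s, ∀ x ∈ I, s < f x → ∃ y ∈ C, s < f y := by
  refine ⟨I ∩ (Set.range ((↑) : ℚ → ℝ) ∪ {x | IsGreatest I x}), Set.inter_subset_left,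
    ((Set.countable_range _).union ?_).mono Set.inter_subset_right, fun f hf s x hx hlt => ?_⟩
  · exact Set.Subsingleton.countable fun x hx y hy => hx.unique hy
  by_cases hgr : IsGreatest I x
  · exact ⟨x, ⟨hx, Or.inr hgr⟩, hlt⟩
  obtain ⟨z, hz, hxz⟩ : ∃ z ∈ I, x < z := by
    by_contra! hcon
    exact hgr ⟨hx, hcon⟩
  have hev : ∀ᶠ y in nhdsWithin x (Set.Ici x), s < f y := (hf x).eventually_const_lt hlt
  obtain ⟨u, hu, hsub⟩ := mem_nhdsGE_iff_exists_Ico_subset.1 hev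
  obtain ⟨q, hxq, hq⟩ := exists_rat_btwn (lt_min hxz (Set.mem_Ioi.1 hu))
  exact ⟨q, ⟨hI.out hx hz ⟨hxq.le, (hq.trans_le (min_le_left _ _)).le⟩, Or.inl ⟨q, rfl⟩⟩,
    hsub ⟨hxq.le, hq.trans_le (min_le_right _ _)⟩⟩

section EmpiricalCDF

variable (ν : Measure ℝ) {n : ℕ}

lemma cdfOf_eq_real (x : ℝ) : cdfOf ν x = ν.real (Set.Iic x) := rfl

lemma cdfOf_nonneg (x : ℝ) : 0 ≤ cdfOf ν x := measureReal_nonneg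

lemma continuousWithinAt_ecdf (ω : Fin n → ℝ) (x : ℝ) :
    ContinuousWithinAt (ecdf n ω) (Set.Ici x) x := by
  refine ContinuousWithinAt.div_const (tendsto_finsetSum _ fun i _ => ?_) _
  refine tendsto_const_nhds.congr' ?_
  by_cases h : ω i ≤ x
  · filter_upwards [self_mem_nhdsWithin] with y hy
    rw [if_pos h, if_pos (h.trans hy)]
  · filter_upwards [mem_nhdsWithin_of_mem_nhds (Iio_mem_nhds (not_le.1 h))] with y hy
    rw [if_neg h, if_neg (not_le.2 hy)]

lemma abs_sum_indicator_Iic_sub (hn : n ≠ 0) (ω : Fin n → ℝ) (x : ℝ) :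
    |(∑ i, (Set.Iic x).indicator 1 (ω i)) - n * ν.real (Set.Iic x)|
      = n * |ecdf n ω x - cdfOf ν x| := by
  have hn' : (n : ℝ) ≠ 0 := by exact_mod_cast hn
  rw [← Nat.abs_cast n, ← abs_mul, mul_sub, cdfOf_eq_real, ecdf, mul_div_cancel₀ _ hn']
  simp [Set.indicator_apply]

variable [IsProbabilityMeasure ν]

lemma cdfOf_eq_cdf (x : ℝ) : cdfOf ν x = cdf ν x := (cdf_eq_real ν x).symm

lemma cdfOf_le_one (x : ℝ) : cdfOf ν x ≤ 1 := measureReal_le_one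

lemma monotone_cdfOf : Monotone (cdfOf ν) := fun x y hxy => by
  simpa only [cdfOf_eq_cdf] using monotone_cdf ν hxy

lemma real_Ioi_eq_one_sub_cdfOf (x : ℝ) : ν.real (Set.Ioi x) = 1 - cdfOf ν x := by
  rw [cdfOf_eq_real, ← probReal_compl_eq_one_sub measurableSet_Iic, Set.compl_Iic]

lemma continuousWithinAt_cdfOf (x : ℝ) : ContinuousWithinAt (cdfOf ν) (Set.Ici x) x := by
  rw [show cdfOf ν = cdf ν from funext (cdfOf_eq_cdf ν)]
  exact (cdf ν).right_continuous x

lemma abs_sum_indicator_Ioi_sub (hn : n ≠ 0) (ω : Fin n → ℝ) (x : ℝ) :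
    |(∑ i, (Set.Ioi x).indicator 1 (ω i)) - n * ν.real (Set.Ioi x)|
      = n * |ecdf n ω x - cdfOf ν x| := by
  have hind : ∀ u, (Set.Ioi x).indicator (1 : ℝ → ℝ) u = 1 - (Set.Iic x).indicator 1 u := by
    intro u
    rw [← Set.compl_Iic, Set.indicator_compl]
    rfl
  rw [← abs_sum_indicator_Iic_sub ν hn, ← abs_neg]
  congr 1
  simp_rw [hind, Finset.sum_sub_distrib, real_Ioi_eq_one_sub_cdfOf, cdfOf_eq_real]
  simp
  ring

lemma measure_exists_cdfOf_le_lt_le (hn : n ≠ 0) {p : ℝ} (hp : p ≤ 1 / 2) {l : ℝ} (hl0 : 0 ≤ l)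
    (hl1 : l ≤ 1) {s : ℝ} (hs : 0 ≤ s) :
    (Measure.pi fun _ : Fin n => ν)
        {ω | ∃ x, cdfOf ν x ≤ p ∧ s < n * |ecdf n ω x - cdfOf ν x|}
      ≤ ENNReal.ofReal (2 * Real.exp (2 * n * p * l ^ 2 - l * s)) := by
  obtain ⟨C, hCI, hC, hCf⟩ := exists_countable_forall_lt_of_continuousWithinAt_Ici
    (I := {x | cdfOf ν x ≤ p}) ⟨fun x _ y hy z hz => (monotone_cdfOf ν hz.2).trans hy⟩
  have key := measure_exists_lt_abs_sum_indicator_sub_le (ι := Fin n) (ν := ν)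
    (S := fun x : ℝ => Set.Iic x) (fun _ => measurableSet_Iic) (fun _ _ h => Set.Iic_subset_Iic.2 h)
    hp hC (fun x hx => hCI hx) hl0 hl1 hs
  simp only [Fintype.card_fin, abs_sum_indicator_Iic_sub ν hn] at key
  refine (measure_mono ?_).trans key
  rintro ω ⟨x, hx, hlt⟩
  exact hCf (fun x => n * |ecdf n ω x - cdfOf ν x|) (fun y => continuousWithinAt_const.mul
    ((continuousWithinAt_ecdf ω y).sub (continuousWithinAt_cdfOf ν y)).abs) s x hx hlt

lemma measure_exists_one_sub_cdfOf_le_lt_le (hn : n ≠ 0) {p : ℝ} (hp : p ≤ 1 / 2) {l : ℝ}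
    (hl0 : 0 ≤ l) (hl1 : l ≤ 1) {s : ℝ} (hs : 0 ≤ s) :
    (Measure.pi fun _ : Fin n => ν)
        {ω | ∃ x, 1 - cdfOf ν x ≤ p ∧ s < n * |ecdf n ω x - cdfOf ν x|}
      ≤ ENNReal.ofReal (2 * Real.exp (2 * n * p * l ^ 2 - l * s)) := by
  obtain ⟨C, hCI, hC, hCf⟩ := exists_countable_forall_lt_of_continuousWithinAt_Ici
    (I := {x | 1 - cdfOf ν x ≤ p})
    ⟨fun x hx y _ z hz => (sub_le_sub_left (monotone_cdfOf ν hz.1) 1).trans hx⟩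
  have key := measure_exists_lt_abs_sum_indicator_sub_le (ι := Fin n) (ν := ν) (κ := ℝᵒᵈ)
    (S := fun x => Set.Ioi (OrderDual.ofDual x)) (fun _ => measurableSet_Ioi)
    (fun _ _ h => Set.Ioi_subset_Ioi h) hp (C := OrderDual.ofDual ⁻¹' C)
    (hC.preimage OrderDual.ofDual.injective)
    (fun x hx => (real_Ioi_eq_one_sub_cdfOf ν _).trans_le (hCI hx)) hl0 hl1 hs
  simp only [Fintype.card_fin, abs_sum_indicator_Ioi_sub ν hn] at key
  refine (measure_mono ?_).trans key
  rintro ω ⟨x, hx, hlt⟩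
  obtain ⟨y, hy, hlt'⟩ := hCf (fun x => n * |ecdf n ω x - cdfOf ν x|)
    (fun y => continuousWithinAt_const.mul
      ((continuousWithinAt_ecdf ω y).sub (continuousWithinAt_cdfOf ν y)).abs) s x hx hlt
  exact ⟨OrderDual.toDual y, hy, hlt'⟩

end EmpiricalCDF

lemma exists_bernstein_exponent_le {σ t : ℝ} (hσ : 0 ≤ σ) (ht : 0 ≤ t) :
    ∃ l, 0 ≤ l ∧ l ≤ 1 ∧
      4 * σ ^ 2 * l ^ 2 - l * (t * σ) ≤ -(1 / 16) * min (t ^ 2) (t * σ) := by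
  have htσ := mul_nonneg ht hσ
  rcases le_total t (8 * σ) with h | h
  · rcases hσ.eq_or_lt with rfl | hσ
    · exact ⟨0, le_rfl, zero_le_one, by simp [sq_nonneg]⟩
    refine ⟨t / (8 * σ), by positivity, (div_le_one (by positivity)).2 h, ?_⟩
    have : 4 * σ ^ 2 * (t / (8 * σ)) ^ 2 - t / (8 * σ) * (t * σ) = -(1 / 16) * t ^ 2 := by
      field_simp
      ring
    rw [this]
    linarith [min_le_left (t ^ 2) (t * σ)]
  · refine ⟨1, zero_le_one, le_rfl, ?_⟩
    nlinarith [min_le_right (t ^ 2) (t * σ)]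

theorem stmt3 :
    ∃ c₁ c₂ : ℝ, 0 < c₁ ∧ 0 < c₂ ∧
      ∀ (n : ℕ), 1 ≤ n →
      ∀ (ν : Measure ℝ) [IsProbabilityMeasure ν],
      ∀ (x₀ x₁ : EReal), x₀ ≤ x₁ →
      ∀ t : ℝ, 0 ≤ t →
        -- V = sup_{x ∈ [x₀,x₁]} F(x)(1-F(x)); the endpoints ±∞ contribute 0 since
        -- F(-∞)(1-F(-∞)) = 0 = F(∞)(1-F(∞)), matching the empty-supremum convention.
        (Measure.pi fun _ : Fin n => ν)
            {ω | t * Real.sqrt ((⨆ x : {x : ℝ // x₀ ≤ (x : EReal) ∧ (x : EReal) ≤ x₁},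
                    cdfOf ν x * (1 - cdfOf ν x)) / n) <
                  ⨆ x : {x : ℝ // x₀ ≤ (x : EReal) ∧ (x : EReal) ≤ x₁},
                    |ecdf n ω x - cdfOf ν x|} ≤
          ENNReal.ofReal (c₁ * Real.exp (-c₂ *
            min (t ^ 2)
              (t * Real.sqrt (n * ⨆ x : {x : ℝ // x₀ ≤ (x : EReal) ∧ (x : EReal) ≤ x₁},
                cdfOf ν x * (1 - cdfOf ν x))))) := by
  refine ⟨4, 1 / 16, by norm_num, by norm_num, fun n hn ν _ x₀ x₁ _ t ht => ?_⟩
  set V := ⨆ x : {x : ℝ // x₀ ≤ (x : EReal) ∧ (x : EReal) ≤ x₁},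
    cdfOf ν x * (1 - cdfOf ν x) with hV
  have hn0 : n ≠ 0 := by omega
  rcases isEmpty_or_nonempty {x : ℝ // x₀ ≤ (x : EReal) ∧ (x : EReal) ≤ x₁} with hemp | hne
  · simp [Real.iSup_of_isEmpty, hV]
  have hquarter : ∀ x, cdfOf ν x * (1 - cdfOf ν x) ≤ 1 / 4 := fun x => by
    nlinarith [sq_nonneg (cdfOf ν x - 1 / 2)]
  have hV4 : V ≤ 1 / 4 := ciSup_le fun x => hquarter x
  have hV0 : 0 ≤ V := Real.iSup_nonneg fun x =>
    mul_nonneg (cdfOf_nonneg ν x) (sub_nonneg.2 (cdfOf_le_one ν x))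
  have hle : ∀ x : {x : ℝ // x₀ ≤ (x : EReal) ∧ (x : EReal) ≤ x₁},
      cdfOf ν x * (1 - cdfOf ν x) ≤ V :=
    le_ciSup (f := fun x : {x : ℝ // x₀ ≤ (x : EReal) ∧ (x : EReal) ≤ x₁} =>
      cdfOf ν x * (1 - cdfOf ν x)) ⟨1 / 4, by rintro _ ⟨x, rfl⟩; exact hquarter x⟩
  have hscale : n * (t * Real.sqrt (V / n)) = t * Real.sqrt (n * V) := by
    have hn' : (n : ℝ) ≠ 0 := by exact_mod_cast hn0
    rw [show n * V = (n : ℝ) ^ 2 * (V / n) by field_simp, Real.sqrt_mul (sq_nonneg _),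
      Real.sqrt_sq n.cast_nonneg]
    ring
  obtain ⟨l, hl0, hl1, hl⟩ := exists_bernstein_exponent_le (Real.sqrt_nonneg (n * V)) ht
  have hs : 0 ≤ t * Real.sqrt (n * V) := by positivity
  have hp : 2 * V ≤ 1 / 2 := by linarith
  have hexp : ENNReal.ofReal
        (2 * Real.exp (2 * n * (2 * V) * l ^ 2 - l * (t * Real.sqrt (n * V))))
      ≤ ENNReal.ofReal
        (2 * Real.exp (-(1 / 16) * min (t ^ 2) (t * Real.sqrt (n * V)))) := by
    refine ENNReal.ofReal_le_ofReal
      (mul_le_mul_of_nonneg_left (Real.exp_le_exp.2 (le_trans (le_of_eq ?_) hl)) zero_le_two)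
    rw [Real.sq_sqrt (by positivity)]
    ring
  have hleft := (measure_exists_cdfOf_le_lt_le ν hn0 hp hl0 hl1 hs).trans hexp
  have hright := (measure_exists_one_sub_cdfOf_le_lt_le ν hn0 hp hl0 hl1 hs).trans hexp
  refine (measure_mono fun ω hω => ?_).trans
    (((measure_union_le _ _).trans (add_le_add hleft hright)).trans_eq ?_)
  · have hlt : t * Real.sqrt (V / n) < ⨆ x : {x : ℝ // x₀ ≤ (x : EReal) ∧ (x : EReal) ≤ x₁},
        |ecdf n ω x - cdfOf ν x| := hω
    obtain ⟨x, hx⟩ := exists_lt_of_lt_ciSup hlt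
    have hx' : t * Real.sqrt (n * V) < n * |ecdf n ω x - cdfOf ν x| := by
      rw [← hscale]
      exact mul_lt_mul_of_pos_left hx (by positivity)
    have h0 := cdfOf_nonneg ν x
    have h1 := cdfOf_le_one ν x
    have hxV := hle x
    rcases le_total (cdfOf ν x) (1 / 2) with h | h
    · exact Or.inl ⟨x, by nlinarith, hx'⟩
    · exact Or.inr ⟨x, by nlinarith, hx'⟩
  · rw [← ENNReal.ofReal_add (by positivity) (by positivity), ← add_mul]
    norm_num
end

section
/- There exist universal constants c_1, c_2 > 0 such that the following holds. Let X_1,…,X_n be i.i.d. uniform random variables on [0,1], and let F_n(x) = (1/n)∑_{i=1}^n 1{X_i ≤ x} be their empirical cumulative distribution function. Then for every q ∈ (0,1/2] and every t > 0, P( sup_{x∈[q/2, q]} |F_n(x) − x| > t·√(q/n) ) ≤ c_1 · exp(−c_2 · min(t², t·√(nq))). -/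
open MeasureTheory ProbabilityTheory Filter ENNReal

/-- The uniform distribution on `[0,1]`. -/
noncomputable def unif : Measure ℝ := volume.restrict (Set.Icc (0 : ℝ) 1)

/-- The centred and rescaled indicator `(1{u ≤ x} - x) / (1 - x)`; as a process in `x` it is a
martingale when `u` is uniformly distributed on `[0,1]`. -/
noncomputable def scaledInd (x u : ℝ) : ℝ := ((if u ≤ x then (1 : ℝ) else 0) - x) / (1 - x)

/-- The sum of `scaledInd x` over a sample, that is `n (F_n(x) - x) / (1 - x)`. -/
noncomputable def scaledSum {n : ℕ} (x : ℝ) (ω : Fin n → ℝ) : ℝ := ∑ i, scaledInd x (ω i)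

/-- `H` depends only on the part of the sample that has been observed up to level `x`. -/
def DeterminedBy {n : ℕ} {β : Type*} (x : ℝ) (H : (Fin n → ℝ) → β) : Prop :=
  ∀ ω ω' : Fin n → ℝ, (∀ j, ω j = ω' j ∨ (x < ω j ∧ x < ω' j)) → H ω = H ω'

instance : IsProbabilityMeasure unif := by
  constructor
  simp [unif]

lemma DeterminedBy.mono {n : ℕ} {β : Type*} {x y : ℝ} (hxy : x ≤ y) {H : (Fin n → ℝ) → β}
    (h : DeterminedBy x H) : DeterminedBy y H := fun ω ω' hω =>
  h ω ω' fun j => (hω j).imp id fun h' => ⟨hxy.trans_lt h'.1, hxy.trans_lt h'.2⟩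

@[fun_prop]
lemma measurable_scaledInd (x : ℝ) : Measurable (scaledInd x) := by
  unfold scaledInd
  exact ((Measurable.ite measurableSet_Iic measurable_const measurable_const).sub_const _).div_const _

@[fun_prop]
lemma measurable_scaledSum {n : ℕ} (x : ℝ) : Measurable (scaledSum (n := n) x) := by
  unfold scaledSum
  fun_prop

lemma scaledInd_eq_one {x u : ℝ} (hx : x < 1) (hu : u ≤ x) : scaledInd x u = 1 := by
  have : 1 - x ≠ 0 := by linarith
  simp [scaledInd, hu, this]

lemma abs_scaledInd_le {x : ℝ} (hx0 : 0 ≤ x) (hx : x ≤ 1 / 2) (u : ℝ) :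
    |scaledInd x u| ≤ 1 := by
  by_cases hu : u ≤ x
  · rw [scaledInd_eq_one (by linarith) hu, abs_one]
  · have h1 : 0 < 1 - x := by linarith
    rw [scaledInd, if_neg hu, abs_div, abs_of_pos h1, div_le_one h1, zero_sub, abs_neg,
      abs_of_nonneg hx0]
    linarith

lemma determinedBy_scaledSum {n : ℕ} (x : ℝ) : DeterminedBy x (scaledSum (n := n) x) := by
  intro ω ω' h
  refine Finset.sum_congr rfl fun j _ => ?_
  rcases h j with h | ⟨h, h'⟩
  · rw [h]
  · simp [scaledInd, not_le.2 h, not_le.2 h']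

lemma abs_scaledSum_le {n : ℕ} {x : ℝ} (hx0 : 0 ≤ x) (hx : x ≤ 1 / 2) (ω : Fin n → ℝ) :
    |scaledSum x ω| ≤ n :=
  (Finset.abs_sum_le_sum_abs _ _).trans <|
    (Finset.sum_le_sum fun i _ => abs_scaledInd_le hx0 hx (ω i)).trans (by simp)

lemma integral_ite_unif {x : ℝ} (hx0 : 0 ≤ x) (hx : x ≤ 1) (a b : ℝ) :
    ∫ u, (if u ≤ x then a else b) ∂unif = x * a + (1 - x) * b := by
  have hreal : unif.real (Set.Iic x) = x := by
    have : Set.Iic x ∩ Set.Icc 0 1 = Set.Icc 0 x := by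
      ext u
      simp only [Set.mem_inter_iff, Set.mem_Iic, Set.mem_Icc]
      grind
    rw [measureReal_def, unif, Measure.restrict_apply measurableSet_Iic, this]
    simp [hx0]
  have h : (fun u : ℝ => if u ≤ x then a else b)
      = fun u => (Set.Iic x).indicator (fun _ => a - b) u + b := by
    funext u
    by_cases hu : u ≤ x <;> simp [Set.indicator, hu]
  rw [h, integral_add ((integrable_const _).indicator measurableSet_Iic) (integrable_const _),
    integral_indicator measurableSet_Iic, setIntegral_const, hreal, integral_const]
  simp
  ring

lemma integrable_scaledInd {x : ℝ} (hx0 : 0 ≤ x) (hx : x ≤ 1 / 2) :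
    Integrable (scaledInd x) unif :=
  Integrable.of_bound (measurable_scaledInd x).aestronglyMeasurable 1
    (ae_of_all _ fun u => abs_scaledInd_le hx0 hx u)

lemma integral_scaledInd {x : ℝ} (hx0 : 0 ≤ x) (hx : x ≤ 1 / 2) :
    ∫ u, scaledInd x u ∂unif = 0 := by
  have h : scaledInd x = fun u => if u ≤ x then (1 - x) / (1 - x) else (0 - x) / (1 - x) := by
    funext u
    by_cases hu : u ≤ x <;> simp [scaledInd, hu]
  rw [h, integral_ite_unif hx0 (by linarith)]
  ring

lemma integral_scaledInd_sub_mul {x y : ℝ} (hx0 : 0 ≤ x) (hxy : x ≤ y) (hy : y ≤ 1 / 2)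
    {h : ℝ → ℝ} (hh : ∀ u v, x < u → x < v → h u = h v) :
    ∫ u, (scaledInd y u - scaledInd x u) * h u ∂unif = 0 := by
  have key : (fun u => (scaledInd y u - scaledInd x u) * h u)
      = fun u => (scaledInd y u - scaledInd x u) * h (x + 1) := by
    funext u
    rcases le_or_gt u x with hu | hu
    · rw [scaledInd_eq_one (by linarith) hu, scaledInd_eq_one (by linarith) (hu.trans hxy)]
      simp
    · rw [hh u (x + 1) hu (by linarith)]
  rw [key, integral_mul_const, integral_sub (integrable_scaledInd (hx0.trans hxy) hy)
    (integrable_scaledInd hx0 (hxy.trans hy)), integral_scaledInd (hx0.trans hxy) hy,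
    integral_scaledInd hx0 (hxy.trans hy)]
  simp

lemma integrable_mul_scaledInd_sub {n : ℕ} {x y : ℝ} (hx0 : 0 ≤ x) (hxy : x ≤ y)
    (hy : y ≤ 1 / 2) (i : Fin n) {H : (Fin n → ℝ) → ℝ}
    (hH : Integrable H (Measure.pi fun _ : Fin n => unif)) :
    Integrable (fun ω => (scaledInd y (ω i) - scaledInd x (ω i)) * H ω)
      (Measure.pi fun _ : Fin n => unif) := by
  refine hH.bdd_mul (c := 2) ?_ (ae_of_all _ fun ω => ?_)
  · exact Measurable.aestronglyMeasurable (by fun_prop)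
  · have h1 := abs_scaledInd_le (hx0.trans hxy) hy (ω i)
    have h2 := abs_scaledInd_le hx0 (hxy.trans hy) (ω i)
    rw [Real.norm_eq_abs]
    exact (abs_sub _ _).trans (by linarith)

lemma integral_pi_scaledInd_sub_mul {n : ℕ} {x y : ℝ} (hx0 : 0 ≤ x) (hxy : x ≤ y)
    (hy : y ≤ 1 / 2) (i : Fin n) {H : (Fin n → ℝ) → ℝ}
    (hH : Integrable H (Measure.pi fun _ : Fin n => unif)) (hdet : DeterminedBy x H) :
    ∫ ω, (scaledInd y (ω i) - scaledInd x (ω i)) * H ω ∂(Measure.pi fun _ : Fin n => unif) = 0 := by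
  obtain _ | m := n
  · exact i.elim0
  have h_int := integrable_mul_scaledInd_sub hx0 hxy hy i hH
  have hmp := (measurePreserving_piFinSuccAbove (fun _ : Fin (m + 1) => unif) i).symm
  rw [← hmp.integral_comp' , integral_prod_symm]
  · refine integral_eq_zero_of_ae (ae_of_all _ fun z => ?_)
    simp only [MeasurableEquiv.piFinSuccAbove_symm_apply, Fin.insertNthEquiv_apply,
      Fin.insertNth_apply_same, Pi.zero_apply]
    refine integral_scaledInd_sub_mul hx0 hxy hy fun u v hu hv => hdet _ _ fun j => ?_
    rcases Fin.eq_self_or_eq_succAbove i j with rfl | ⟨k, rfl⟩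
    · simp [hu, hv]
    · simp
  · exact (hmp.integrable_comp_emb (MeasurableEquiv.measurableEmbedding _)).2 h_int

lemma integrable_exp_scaledSum {n : ℕ} {x : ℝ} (hx0 : 0 ≤ x) (hx : x ≤ 1 / 2) (l : ℝ) :
    Integrable (fun ω => Real.exp (l * scaledSum x ω)) (Measure.pi fun _ : Fin n => unif) := by
  refine Integrable.of_bound (Measurable.aestronglyMeasurable (by fun_prop)) (Real.exp (|l| * n))
    (ae_of_all _ fun ω => ?_)
  rw [Real.norm_eq_abs, Real.abs_exp, Real.exp_le_exp]
  refine (le_abs_self _).trans ?_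
  rw [abs_mul]
  exact mul_le_mul_of_nonneg_left (abs_scaledSum_le hx0 hx ω) (abs_nonneg l)

/-- The submartingale property of `x ↦ exp (l * scaledSum x)`. -/
lemma setIntegral_exp_scaledSum_mono {n : ℕ} {x y : ℝ} (hx0 : 0 ≤ x) (hxy : x ≤ y)
    (hy : y ≤ 1 / 2) (l : ℝ) {A : Set (Fin n → ℝ)} (hA : MeasurableSet A)
    (hdet : DeterminedBy x (· ∈ A)) :
    ∫ ω in A, Real.exp (l * scaledSum x ω) ∂(Measure.pi fun _ : Fin n => unif) ≤
      ∫ ω in A, Real.exp (l * scaledSum y ω) ∂(Measure.pi fun _ : Fin n => unif) := by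
  set H : (Fin n → ℝ) → ℝ := A.indicator fun ω => Real.exp (l * scaledSum x ω) with hHdef
  have hH : Integrable H (Measure.pi fun _ : Fin n => unif) :=
    (integrable_exp_scaledSum hx0 (hxy.trans hy) l).indicator hA
  have hHdet : DeterminedBy x H := by
    intro ω ω' h
    have h1 : ω ∈ A ↔ ω' ∈ A := iff_of_eq (hdet ω ω' h)
    by_cases hω : ω ∈ A
    · simp only [hHdef, Set.indicator_of_mem hω, Set.indicator_of_mem (h1.1 hω),
        determinedBy_scaledSum x ω ω' h]
    · simp only [hHdef, Set.indicator_of_notMem hω, Set.indicator_of_notMem (mt h1.2 hω)]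
  have hzero : ∫ ω, ∑ i, l * ((scaledInd y (ω i) - scaledInd x (ω i)) * H ω)
      ∂(Measure.pi fun _ : Fin n => unif) = 0 := by
    rw [integral_finsetSum _ fun i _ =>
      (integrable_mul_scaledInd_sub hx0 hxy hy i hH).const_mul l]
    refine Finset.sum_eq_zero fun i _ => ?_
    rw [integral_const_mul, integral_pi_scaledInd_sub_mul hx0 hxy hy i hH hHdet, mul_zero]
  have h_int : Integrable (fun ω => ∑ i, l * ((scaledInd y (ω i) - scaledInd x (ω i)) * H ω))
      (Measure.pi fun _ : Fin n => unif) := integrable_finsetSum _ fun i _ =>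
    (integrable_mul_scaledInd_sub hx0 hxy hy i hH).const_mul l
  rw [← integral_indicator hA, ← integral_indicator hA]
  calc ∫ ω, H ω ∂(Measure.pi fun _ : Fin n => unif)
      = ∫ ω, (H ω + ∑ i, l * ((scaledInd y (ω i) - scaledInd x (ω i)) * H ω))
          ∂(Measure.pi fun _ : Fin n => unif) := by
        rw [integral_add hH h_int, hzero, add_zero]
    _ ≤ _ := by
        refine integral_mono (hH.add h_int)
          ((integrable_exp_scaledSum (hx0.trans hxy) hy l).indicator hA) fun ω => ?_
        have hsum : ∑ i, l * ((scaledInd y (ω i) - scaledInd x (ω i)) * H ω)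
            = l * (scaledSum y ω - scaledSum x ω) * H ω := by
          rw [← Finset.mul_sum, ← Finset.sum_mul, Finset.sum_sub_distrib, mul_assoc]
          rfl
        rw [hsum]
        simp only [hHdef]
        by_cases hω : ω ∈ A
        · simp only [Set.indicator_of_mem hω]
          have h1 := Real.add_one_le_exp (l * (scaledSum y ω - scaledSum x ω))
          have h2 : Real.exp (l * scaledSum y ω) = Real.exp (l * scaledSum x ω)
              * Real.exp (l * (scaledSum y ω - scaledSum x ω)) := by
            rw [← Real.exp_add]
            ring_nf
          rw [h2]
          nlinarith [Real.exp_pos (l * scaledSum x ω)]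
        · simp [Set.indicator_of_notMem hω]

/-- Doob's maximal inequality for `exp (l * scaledSum x)` along a finite monotone grid. -/
lemma exp_mul_measureReal_le {n : ℕ} {x : ℕ → ℝ} (hmono : Monotone x) (hx0 : 0 ≤ x 0)
    (l a : ℝ) (N : ℕ) (hN : x N ≤ 1 / 2) :
    Real.exp a * (Measure.pi fun _ : Fin n => unif).real
        {ω | ∃ k ≤ N, a ≤ l * scaledSum (x k) ω} ≤
      ∫ ω in {ω | ∃ k ≤ N, a ≤ l * scaledSum (x k) ω}, Real.exp (l * scaledSum (x N) ω)
        ∂(Measure.pi fun _ : Fin n => unif) := by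
  have hE : ∀ k, MeasurableSet {ω : Fin n → ℝ | a ≤ l * scaledSum (x k) ω} := fun k =>
    measurableSet_le (by fun_prop) (by fun_prop)
  have hU : ∀ N, MeasurableSet {ω : Fin n → ℝ | ∃ k ≤ N, a ≤ l * scaledSum (x k) ω} := by
    intro N
    simp only [Set.ofPred_exists, Set.ofPred_and]
    exact MeasurableSet.iUnion fun k => (MeasurableSet.const _).inter (hE k)
  have hlow : ∀ k, x k ≤ 1 / 2 → ∀ A : Set (Fin n → ℝ), MeasurableSet A →
      (∀ ω ∈ A, a ≤ l * scaledSum (x k) ω) →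
      Real.exp a * (Measure.pi fun _ : Fin n => unif).real A ≤
        ∫ ω in A, Real.exp (l * scaledSum (x k) ω) ∂(Measure.pi fun _ : Fin n => unif) := by
    intro k hk A hA h
    have := setIntegral_mono_on (μ := Measure.pi fun _ : Fin n => unif)
      (integrable_const (Real.exp a)).integrableOn
      (integrable_exp_scaledSum (n := n) (hx0.trans (hmono k.zero_le)) hk l).integrableOn hA
      fun ω hω => Real.exp_le_exp.2 (h ω hω)
    rwa [setIntegral_const, smul_eq_mul, mul_comm] at this
  induction N with
  | zero =>
    refine hlow 0 hN _ (hU 0) ?_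
    rintro ω ⟨k, hk, h⟩
    obtain rfl : k = 0 := by omega
    exact h
  | succ N ih =>
    have hstep := hmono N.le_succ
    have ih := ih (hstep.trans hN)
    set U : Set (Fin n → ℝ) := {ω | ∃ k ≤ N, a ≤ l * scaledSum (x k) ω} with hUdef
    have hsplit : {ω : Fin n → ℝ | ∃ k ≤ N + 1, a ≤ l * scaledSum (x k) ω}
        = U ∪ ({ω | a ≤ l * scaledSum (x (N + 1)) ω} \ U) := by
      rw [Set.union_sdiff_self]
      ext ω
      simp only [hUdef, Set.mem_union, Set.mem_ofPred_eq, Nat.le_add_one_iff, or_and_right,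
        exists_or, exists_eq_left]
    have hdisj : Disjoint U ({ω | a ≤ l * scaledSum (x (N + 1)) ω} \ U) :=
      Set.disjoint_sdiff_right
    have hmeas := (hE (N + 1)).diff (hU N)
    have h_int := integrable_exp_scaledSum (n := n) (hx0.trans (hmono (N + 1).zero_le)) hN l
    rw [hsplit, measureReal_union hdisj hmeas,
      setIntegral_union hdisj hmeas h_int.integrableOn h_int.integrableOn, mul_add]
    refine add_le_add (ih.trans ?_) (hlow _ hN _ hmeas fun ω hω => hω.1)
    refine setIntegral_exp_scaledSum_mono (hx0.trans (hmono N.zero_le)) hstep hN l (hU N) ?_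
    intro ω ω' h
    refine propext (exists_congr fun k => and_congr_right fun hk => ?_)
    rw [(determinedBy_scaledSum (x k)).mono (hmono hk) ω ω' h]

lemma integral_exp_scaledInd_le {q l : ℝ} (hq0 : 0 ≤ q) (hq : q ≤ 1 / 2) (hl : |l| ≤ 1 / 2) :
    ∫ u, Real.exp (l * scaledInd q u) ∂unif ≤ Real.exp (4 * q * l ^ 2) := by
  have h1 : 0 < 1 - q := by linarith
  set m := l / (1 - q) with hm
  have hlm : l = m * (1 - q) := by
    rw [hm]
    field_simp
  have hm2 : |m| ≤ 2 * |l| := by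
    rw [hm, abs_div, abs_of_pos h1, div_le_iff₀ h1]
    nlinarith [abs_nonneg l]
  have h : (fun u => Real.exp (l * scaledInd q u))
      = fun u => if u ≤ q then Real.exp (m * (1 - q)) else Real.exp (m * (0 - q)) := by
    funext u
    have : l * scaledInd q u = m * ((if u ≤ q then (1 : ℝ) else 0) - q) := by
      rw [scaledInd, hm]
      ring
    rw [this]
    split_ifs <;> rfl
  rw [h, integral_ite_unif hq0 (by linarith)]
  have hexp : Real.exp m ≤ 1 + m + m ^ 2 := by
    have := (abs_le.1 (Real.abs_exp_sub_one_sub_id_le (x := m) (by linarith))).2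
    linarith
  have hsq : m ^ 2 ≤ 4 * l ^ 2 := by
    have := pow_le_pow_left₀ (abs_nonneg m) hm2 2
    rw [mul_pow, sq_abs, sq_abs] at this
    linarith
  calc q * Real.exp (m * (1 - q)) + (1 - q) * Real.exp (m * (0 - q))
      = Real.exp (-(m * q)) * (q * (Real.exp m - 1) + 1) := by
        rw [show m * (1 - q) = -(m * q) + m by ring, Real.exp_add,
          show m * (0 - q) = -(m * q) by ring]
        ring
    _ ≤ Real.exp (-(m * q)) * Real.exp (q * (m + m ^ 2)) := by
        gcongr
        refine le_trans ?_ (Real.add_one_le_exp _)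
        gcongr
        linarith
    _ = Real.exp (q * m ^ 2) := by
        rw [← Real.exp_add]
        ring_nf
    _ ≤ Real.exp (4 * q * l ^ 2) := by
        rw [Real.exp_le_exp]
        nlinarith

lemma integral_exp_scaledSum_le {n : ℕ} {q l : ℝ} (hq0 : 0 ≤ q) (hq : q ≤ 1 / 2)
    (hl : |l| ≤ 1 / 2) :
    ∫ ω, Real.exp (l * scaledSum q ω) ∂(Measure.pi fun _ : Fin n => unif) ≤
      Real.exp (4 * (n * q) * l ^ 2) := by
  have h : (fun ω : Fin n → ℝ => Real.exp (l * scaledSum q ω))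
      = fun ω => ∏ i, Real.exp (l * scaledInd q (ω i)) := by
    funext ω
    rw [scaledSum, Finset.mul_sum, Real.exp_sum]
  rw [h, integral_fintype_prod_eq_prod (fun (_ : Fin n) u => Real.exp (l * scaledInd q u)),
    Finset.prod_const, Finset.card_univ, Fintype.card_fin,
    show 4 * (n * q) * l ^ 2 = n * (4 * q * l ^ 2) by ring, Real.exp_nat_mul]
  exact pow_le_pow_left₀ (integral_nonneg fun _ => (Real.exp_pos _).le)
    (integral_exp_scaledInd_le hq0 hq hl) n

lemma measureReal_exists_scaledSum_le {n : ℕ} {x : ℕ → ℝ} (hmono : Monotone x) (hx0 : 0 ≤ x 0)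
    {l : ℝ} (hl : |l| ≤ 1 / 2) (a : ℝ) (N : ℕ) (hN : x N ≤ 1 / 2) :
    (Measure.pi fun _ : Fin n => unif).real {ω | ∃ k ≤ N, a ≤ l * scaledSum (x k) ω} ≤
      Real.exp (4 * (n * x N) * l ^ 2 - a) := by
  have hN0 := hx0.trans (hmono N.zero_le)
  rw [Real.exp_sub, le_div_iff₀ (Real.exp_pos a), mul_comm]
  exact (exp_mul_measureReal_le hmono hx0 l a N hN).trans <|
    (setIntegral_le_integral (integrable_exp_scaledSum hN0 hN l)
      (ae_of_all _ fun ω => (Real.exp_pos _).le)).trans (integral_exp_scaledSum_le hN0 hN hl)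

lemma scaledSum_eq {n : ℕ} (hn : n ≠ 0) (x : ℝ) (ω : Fin n → ℝ) :
    scaledSum x ω = n * (ecdf n ω x - x) / (1 - x) := by
  have hn' : (n : ℝ) ≠ 0 := Nat.cast_ne_zero.2 hn
  simp only [scaledSum, scaledInd, ecdf, ← Finset.sum_div, Finset.sum_sub_distrib]
  rw [mul_sub, mul_div_cancel₀ _ hn']
  simp

lemma ecdf_mono (n : ℕ) (ω : Fin n → ℝ) : Monotone (ecdf n ω) := by
  intro x y hxy
  unfold ecdf
  gcongr with i
  by_cases h : ω i ≤ x
  · simp [h, h.trans hxy]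
  · rw [if_neg h]
    split_ifs <;> norm_num

/-- The equispaced grid of mesh `q / (2 * N)` that starts at `q / 2`. -/
noncomputable def halfGrid (q : ℝ) (N k : ℕ) : ℝ := q / 2 + k * (q / (2 * N))

lemma monotone_halfGrid {q : ℝ} (hq : 0 ≤ q) (N : ℕ) : Monotone (halfGrid q N) := by
  intro j k hjk
  unfold halfGrid
  gcongr

lemma halfGrid_self (q : ℝ) {N : ℕ} (hN : N ≠ 0) : halfGrid q N N = q := by
  have : (N : ℝ) ≠ 0 := Nat.cast_ne_zero.2 hN
  unfold halfGrid
  field_simp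
  ring

lemma exists_halfGrid_bracket {q x : ℝ} {N : ℕ} (hN : N ≠ 0) (hx : x ∈ Set.Icc (q / 2) q) :
    ∃ k < N, halfGrid q N k ≤ x ∧ x ≤ halfGrid q N (k + 1) := by
  by_contra! h
  have key : ∀ k ≤ N, halfGrid q N k ≤ x := by
    intro k
    induction k with
    | zero => exact fun _ => by simpa [halfGrid] using hx.1
    | succ k ih => exact fun hk => (h k hk (ih (by omega))).le
  obtain ⟨M, rfl⟩ := Nat.exists_eq_succ_of_ne_zero hN
  have := h M (by omega) (key M (by omega))
  rw [← Nat.succ_eq_add_one, halfGrid_self q hN] at this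
  exact absurd hx.2 (not_le.2 this)

/-- Monotonicity of the empirical distribution function controls its deviation between grid
points. -/
lemma iSup_abs_ecdf_sub_le {n N : ℕ} {q s : ℝ} (hq : 0 ≤ q) (hN : N ≠ 0) (ω : Fin n → ℝ)
    (h : ∀ k ≤ N, |ecdf n ω (halfGrid q N k) - halfGrid q N k| ≤ s) :
    ⨆ x : Set.Icc (q / 2) q, |ecdf n ω x - x| ≤ s + q / (2 * N) := by
  have : Nonempty (Set.Icc (q / 2) q) := ⟨⟨q, by linarith, le_rfl⟩⟩
  refine ciSup_le fun ⟨x, hx⟩ => ?_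
  obtain ⟨k, hk, h1, h2⟩ := exists_halfGrid_bracket hN hx
  have hstep : halfGrid q N (k + 1) = halfGrid q N k + q / (2 * N) := by
    simp only [halfGrid, Nat.cast_add, Nat.cast_one]
    ring
  have e1 := ecdf_mono n ω h1
  have e2 := ecdf_mono n ω h2
  have a1 := abs_le.1 (h k hk.le)
  have a2 := abs_le.1 (h (k + 1) hk)
  exact abs_le.2 ⟨by linarith [a1.1], by linarith [a2.2]⟩

lemma mul_sq_sub_le_neg_min {t R l : ℝ} (ht : 0 < t) (hR : 0 < R)
    (hl : l = min (t / (16 * R)) (1 / 2)) :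
    4 * R ^ 2 * l ^ 2 - l * (t / 2 * R) ≤ -(1 / 64) * min (t ^ 2) (t * R) := by
  have h1 : l ≤ t / (16 * R) := hl ▸ min_le_left _ _
  have h0 : 0 < l := hl ▸ lt_min (by positivity) (by norm_num)
  have h2 : 16 * R * l ≤ t := by
    rwa [le_div_iff₀ (by positivity), mul_comm] at h1
  have h3 : 4 * R ^ 2 * l ^ 2 ≤ l * t * R / 4 := by
    nlinarith [mul_le_mul_of_nonneg_left h2 (mul_pos hR h0).le]
  have h4 : min (t ^ 2) (t * R) ≤ 16 * (l * t * R) := by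
    rcases min_choice (t / (16 * R)) (1 / 2) with h | h
    · refine (min_le_left _ _).trans_eq ?_
      rw [hl, h]
      field_simp
    · refine (min_le_right _ _).trans ?_
      rw [hl, h]
      nlinarith [mul_pos ht hR]
  linarith

theorem stmt5 :
    ∃ c₁ c₂ : ℝ, 0 < c₁ ∧ 0 < c₂ ∧
      ∀ (n : ℕ), 1 ≤ n →
      ∀ q : ℝ, 0 < q → q ≤ 1 / 2 →
      ∀ t : ℝ, 0 < t →
        (Measure.pi fun _ : Fin n => unif)
            {ω | t * Real.sqrt (q / n) <
                  ⨆ x : Set.Icc (q / 2) q, |ecdf n ω x - x|} ≤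
          ENNReal.ofReal (c₁ * Real.exp (-c₂ *
            min (t ^ 2) (t * Real.sqrt (n * q)))) := by
  refine ⟨2, 1 / 64, by norm_num, by norm_num, fun n hn q hq0 hq t ht => ?_⟩
  have hn0 : n ≠ 0 := by omega
  have hnpos : (0 : ℝ) < n := by exact_mod_cast hn
  have hRpos : 0 < Real.sqrt (n * q) := Real.sqrt_pos.2 (by positivity)
  have hRsq : Real.sqrt (n * q) ^ 2 = n * q := Real.sq_sqrt (by positivity)
  have hns : n * Real.sqrt (q / n) = Real.sqrt (n * q) := by
    rw [← sq_eq_sq₀ (by positivity) (by positivity), hRsq, mul_pow, Real.sq_sqrt (by positivity)]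
    field_simp
  set R := Real.sqrt (n * q)
  set r := Real.sqrt (q / n)
  have hrpos : 0 < r := Real.sqrt_pos.2 (by positivity)
  obtain ⟨N, hN⟩ := exists_nat_gt (q / (t * r))
  have hNpos : (0 : ℝ) < N := lt_trans (by positivity) hN
  have hN0 : N ≠ 0 := by
    rintro rfl
    simp at hNpos
  have hmesh : q / (2 * N) ≤ t / 2 * r := by
    rw [div_lt_iff₀ (by positivity)] at hN
    rw [div_le_iff₀ (by positivity)]
    linarith
  have hself := halfGrid_self q hN0
  have hgrid := monotone_halfGrid hq0.le N
  have hgrid0 : 0 ≤ halfGrid q N 0 := by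
    unfold halfGrid
    positivity
  obtain ⟨l, hl⟩ : ∃ l, l = min (t / (16 * R)) (1 / 2) := ⟨_, rfl⟩
  have hlpos : 0 < l := hl ▸ lt_min (by positivity) (by norm_num)
  have hlabs : |l| ≤ 1 / 2 := by
    rw [abs_of_pos hlpos, hl]
    exact min_le_right _ _
  set U : ℝ → Set (Fin n → ℝ) := fun l' =>
    {ω | ∃ k ≤ N, l * (t / 2 * R) ≤ l' * scaledSum (halfGrid q N k) ω} with hU
  have hbound : ∀ l', |l'| = |l| → (Measure.pi fun _ : Fin n => unif).real (U l') ≤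
      Real.exp (-(1 / 64) * min (t ^ 2) (t * R)) := by
    intro l' hl'
    refine (measureReal_exists_scaledSum_le hgrid hgrid0 (hl'.trans_le hlabs) _ N
      (hself.trans_le hq)).trans ?_
    rw [Real.exp_le_exp, hself, ← hRsq, (sq_eq_sq_iff_abs_eq_abs _ _).2 hl']
    exact mul_sq_sub_le_neg_min ht hRpos hl
  have hsub : {ω : Fin n → ℝ | t * r < ⨆ x : Set.Icc (q / 2) q, |ecdf n ω x - x|}
      ⊆ U l ∪ U (-l) := by
    intro ω hω
    by_contra hnot
    refine absurd hω (not_lt.2 ((iSup_abs_ecdf_sub_le (s := t / 2 * r) hq0.le hN0 ω ?_).trans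
      (by linarith)))
    intro k hk
    by_contra! hgt
    apply hnot
    have hx0 : 0 ≤ halfGrid q N k := hgrid0.trans (hgrid k.zero_le)
    have hx1 : halfGrid q N k ≤ q := (hgrid hk).trans_eq hself
    have hS : t / 2 * R ≤ |scaledSum (halfGrid q N k) ω| := by
      have h1 : 0 < 1 - halfGrid q N k := by linarith
      rw [scaledSum_eq hn0, abs_div, abs_mul, abs_of_pos hnpos, abs_of_pos h1, le_div_iff₀ h1]
      calc t / 2 * R * (1 - halfGrid q N k) ≤ t / 2 * R * 1 := by gcongr; linarith
        _ = n * (t / 2 * r) := by rw [← hns]; ring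
        _ ≤ _ := by gcongr
    rcases le_abs.1 hS with h | h
    · exact Or.inl ⟨k, hk, mul_le_mul_of_nonneg_left h hlpos.le⟩
    · refine Or.inr ⟨k, hk, ?_⟩
      rw [neg_mul_comm]
      exact mul_le_mul_of_nonneg_left h hlpos.le
  rw [← ofReal_measureReal]
  refine ENNReal.ofReal_le_ofReal ?_
  calc _ ≤ (Measure.pi fun _ : Fin n => unif).real (U l ∪ U (-l)) := measureReal_mono hsub
    _ ≤ _ := measureReal_union_le _ _
    _ ≤ _ := by linarith [hbound l rfl, hbound (-l) (abs_neg l)]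
end
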